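/- arXiv:2407.19223 — 2 statements merged into one kernel-verified Lean document; each statement's English description precedes it below -/
import Mathlib

section
/- For every integer n ≥ 2, Σ_{ν=1}^{n−1} (C_n(ν))² = n(n² − 1)/3 − S_n². -/
open Real Finset

/-- `C n ν = Σ_{l=1}^{n-1} cos(2πνl/n) · csc(πl/n)`. -/
noncomputable def C (n : ℕ) (ν : ℤ) : ℝ :=
  ∑ l ∈ Finset.Icc 1 (n - 1), Real.cos (2 * π * ν * l / n) / Real.sin (π * l / n)

/-- Watson's sum `S n = Σ_{l=1}^{n-1} csc(πl/n)`. -/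
noncomputable def S (n : ℕ) : ℝ :=
  ∑ l ∈ Finset.Icc 1 (n - 1), 1 / Real.sin (π * l / n)

lemma sum_range_eq_add_sum_Icc (f : ℕ → ℝ) {n : ℕ} (hn : 0 < n) :
    ∑ k ∈ range n, f k = f 0 + ∑ k ∈ Finset.Icc 1 (n - 1), f k := by
  obtain ⟨N, rfl⟩ := Nat.exists_eq_succ_of_ne_zero hn.ne'
  rw [Finset.range_eq_Ico, Finset.sum_eq_sum_Ico_succ_bot (Nat.succ_pos N)]
  rfl

lemma sin_pi_mul_div_ne_zero {n : ℕ} (hn : 0 < n) {m : ℤ} (hm : ¬ (n : ℤ) ∣ m) :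
    Real.sin (π * m / n) ≠ 0 := by
  have hn' : (n : ℝ) ≠ 0 := by positivity
  rw [Ne, Real.sin_eq_zero_iff]
  rintro ⟨k, hk⟩
  refine hm ⟨k, ?_⟩
  field_simp at hk
  exact_mod_cast hk.symm.trans (mul_comm _ _)

lemma sin_pi_mul_nat_div_ne_zero {n l : ℕ} (hl : l ∈ Finset.Icc 1 (n - 1)) :
    Real.sin (π * l / n) ≠ 0 := by
  rw [Finset.mem_Icc] at hl
  have h : ¬ (n : ℤ) ∣ (l : ℤ) := by
    rw [Int.natCast_dvd_natCast]
    exact Nat.not_dvd_of_pos_of_lt (by omega) (by omega)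
  exact_mod_cast sin_pi_mul_div_ne_zero (by omega) h

/-- The sum of the real parts of the powers of an `n`-th root of unity other than `1`. -/
lemma sum_cos_eq_zero {n : ℕ} (hn : 0 < n) {m : ℤ} (hm : ¬ (n : ℤ) ∣ m) :
    ∑ k ∈ range n, Real.cos (2 * π * k * m / n) = 0 := by
  have hn' : (n : ℝ) ≠ 0 := by positivity
  have h : ∀ N : ℕ, 2 * Real.sin (π * m / n) * ∑ k ∈ range N, Real.cos (2 * π * k * m / n)
      = Real.sin (2 * π * N * m / n - π * m / n) + Real.sin (π * m / n) := by
    intro N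
    induction N with
    | zero => simp
    | succ N ih =>
      rw [Finset.sum_range_succ, mul_add, ih]
      have e : 2 * π * ((N + 1 : ℕ) : ℝ) * m / n - π * m / n
          = 2 * π * N * m / n + π * m / n := by
        push_cast; ring
      rw [e, Real.sin_add, Real.sin_sub]
      ring
  have h1 := h n
  have e : 2 * π * (n : ℝ) * m / n - π * m / n = m * (2 * π) - π * m / n := by
    field_simp
  rw [e, Real.sin_int_mul_two_pi_sub, neg_add_cancel] at h1
  exact (mul_eq_zero.1 h1).resolve_left
    (mul_ne_zero two_ne_zero (sin_pi_mul_div_ne_zero hn hm))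

lemma sum_cos_of_dvd {n : ℕ} (hn : 0 < n) {m : ℤ} (hm : (n : ℤ) ∣ m) :
    ∑ k ∈ range n, Real.cos (2 * π * k * m / n) = n := by
  have hn' : (n : ℝ) ≠ 0 := by positivity
  obtain ⟨c, rfl⟩ := hm
  have h : ∀ k ∈ range n, Real.cos (2 * π * k * ((n * c : ℤ) : ℝ) / n) = 1 := by
    intro k _
    have e : 2 * π * k * ((n * c : ℤ) : ℝ) / n = ((k * c : ℤ) : ℝ) * (2 * π) := by
      push_cast; field_simp
    rw [e, Real.cos_int_mul_two_pi]
  rw [Finset.sum_congr rfl h]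
  simp

lemma sum_cos_mul_cos {n l m : ℕ} (hl : l ∈ Finset.Icc 1 (n - 1))
    (hm : m ∈ Finset.Icc 1 (n - 1)) :
    ∑ k ∈ range n, Real.cos (2 * π * k * l / n) * Real.cos (2 * π * k * m / n)
      = (if m = l then (n : ℝ) / 2 else 0) + (if m = n - l then (n : ℝ) / 2 else 0) := by
  rw [Finset.mem_Icc] at hl hm
  have hn : 0 < n := by omega
  have h : ∀ k ∈ range n, Real.cos (2 * π * k * l / n) * Real.cos (2 * π * k * m / n)
      = (Real.cos (2 * π * k * ((l - m : ℤ) : ℝ) / n)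
        + Real.cos (2 * π * k * ((l + m : ℤ) : ℝ) / n)) / 2 := by
    intro k _
    have e1 : 2 * π * k * ((l - m : ℤ) : ℝ) / n
        = 2 * π * k * l / n - 2 * π * k * m / n := by push_cast; ring
    have e2 : 2 * π * k * ((l + m : ℤ) : ℝ) / n
        = 2 * π * k * l / n + 2 * π * k * m / n := by push_cast; ring
    rw [e1, e2, Real.cos_add, Real.cos_sub]
    ring
  rw [Finset.sum_congr rfl h, ← Finset.sum_div, Finset.sum_add_distrib, add_div]
  congr 1
  · split_ifs with hlm
    · rw [sum_cos_of_dvd hn (by simp [hlm])]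
    · rw [sum_cos_eq_zero hn, zero_div]
      intro hd
      have := Int.eq_zero_of_abs_lt_dvd hd (by rw [abs_lt]; omega)
      omega
  · split_ifs with hlm
    · rw [sum_cos_of_dvd hn ⟨1, by omega⟩]
    · rw [sum_cos_eq_zero hn, zero_div]
      intro hd
      have hd' : (n : ℤ) ∣ (l + m : ℤ) - n := dvd_sub_self_right.2 hd
      have := Int.eq_zero_of_abs_lt_dvd hd' (by rw [abs_lt]; omega)
      omega

lemma sum_range_two_mul_sq_sub (n N : ℕ) :
    ∑ k ∈ range N, (2 * (k : ℝ) ^ 2 - 2 * n * k)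
      = ((N : ℝ) - 1) * N * (2 * N - 1) / 3 - n * (N * ((N : ℝ) - 1)) := by
  induction N with
  | zero => simp
  | succ N ih => rw [Finset.sum_range_succ, ih]; push_cast; ring

lemma sum_cos_div_sin_sq {n k : ℕ} (hn : 0 < n) (hk : k < n) :
    ∑ l ∈ Finset.Icc 1 (n - 1), Real.cos (2 * π * k * l / n) / Real.sin (π * l / n) ^ 2
      = ∑ l ∈ Finset.Icc 1 (n - 1), 1 / Real.sin (π * l / n) ^ 2
        + (2 * (k : ℝ) ^ 2 - 2 * n * k) := by
  have hcos : ∀ j : ℕ, 0 < j → j < n →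
      ∑ l ∈ Finset.Icc 1 (n - 1), Real.cos (2 * π * j * l / n) = -1 := by
    intro j hj hjn
    have hd : ¬ (n : ℤ) ∣ (j : ℤ) := by
      rw [Int.natCast_dvd_natCast]
      exact Nat.not_dvd_of_pos_of_lt hj hjn
    have h := sum_cos_eq_zero hn hd
    rw [sum_range_eq_add_sum_Icc _ hn] at h
    simp only [CharP.cast_eq_zero, mul_zero, zero_mul, zero_div, Real.cos_zero] at h
    have e : ∀ l ∈ Finset.Icc 1 (n - 1), Real.cos (2 * π * j * l / n)
        = Real.cos (2 * π * l * ((j : ℤ) : ℝ) / n) := by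
      intro l _
      congr 1
      push_cast; ring
    rw [Finset.sum_congr rfl e]
    linarith
  induction k using Nat.twoStepInduction with
  | zero => simp
  | one =>
    have e : ∀ l ∈ Finset.Icc 1 (n - 1),
        Real.cos (2 * π * (1 : ℕ) * l / n) / Real.sin (π * l / n) ^ 2
          = 1 / Real.sin (π * l / n) ^ 2 - 2 := by
      intro l hl
      have hs := sin_pi_mul_nat_div_ne_zero hl
      have e : 2 * π * ((1 : ℕ) : ℝ) * l / n = 2 * (π * l / n) := by push_cast; ring
      rw [e, Real.cos_two_mul, Real.cos_sq']
      field_simp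
      ring
    rw [Finset.sum_congr rfl e, Finset.sum_sub_distrib]
    simp only [Finset.sum_const, Nat.card_Icc, add_tsub_cancel_right, nsmul_eq_mul]
    rw [Nat.cast_sub hn]
    push_cast; ring
  | more k ih0 ih1 =>
    have e : ∀ l ∈ Finset.Icc 1 (n - 1),
        Real.cos (2 * π * (k + 2 : ℕ) * l / n) / Real.sin (π * l / n) ^ 2
          = 2 * (Real.cos (2 * π * (k + 1 : ℕ) * l / n) / Real.sin (π * l / n) ^ 2)
            - Real.cos (2 * π * k * l / n) / Real.sin (π * l / n) ^ 2
            - 4 * Real.cos (2 * π * (k + 1 : ℕ) * l / n) := by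
      intro l hl
      have hs := sin_pi_mul_nat_div_ne_zero hl
      have e2 : 2 * π * ((k + 2 : ℕ) : ℝ) * l / n
          = 2 * π * (k + 1 : ℕ) * l / n + 2 * (π * l / n) := by push_cast; ring
      have e0 : 2 * π * (k : ℝ) * l / n
          = 2 * π * (k + 1 : ℕ) * l / n - 2 * (π * l / n) := by push_cast; ring
      rw [e2, e0, Real.cos_add, Real.cos_sub, Real.cos_two_mul, Real.cos_sq']
      field_simp
      ring
    rw [Finset.sum_congr rfl e, Finset.sum_sub_distrib, Finset.sum_sub_distrib,
      ← Finset.mul_sum, ← Finset.mul_sum, ih0 (by omega), ih1 (by omega),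
      hcos (k + 1) (by omega) (by omega)]
    push_cast; ring

lemma sum_one_div_sin_sq {n : ℕ} (hn : 0 < n) :
    ∑ l ∈ Finset.Icc 1 (n - 1), 1 / Real.sin (π * l / n) ^ 2 = ((n : ℝ) ^ 2 - 1) / 3 := by
  have hn' : (n : ℝ) ≠ 0 := by positivity
  have h0 : ∑ k ∈ range n, ∑ l ∈ Finset.Icc 1 (n - 1),
      Real.cos (2 * π * k * l / n) / Real.sin (π * l / n) ^ 2 = 0 := by
    rw [Finset.sum_comm]
    refine Finset.sum_eq_zero fun l hl => ?_
    rw [← Finset.sum_div]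
    rw [Finset.mem_Icc] at hl
    have hd : ¬ (n : ℤ) ∣ (l : ℤ) := by
      rw [Int.natCast_dvd_natCast]
      exact Nat.not_dvd_of_pos_of_lt (by omega) (by omega)
    have := sum_cos_eq_zero hn hd
    rw [Int.cast_natCast] at this
    rw [this, zero_div]
  rw [Finset.sum_congr rfl fun k hk => sum_cos_div_sin_sq hn (Finset.mem_range.1 hk),
    Finset.sum_add_distrib, sum_range_two_mul_sq_sub, Finset.sum_const, Finset.card_range,
    nsmul_eq_mul] at h0
  apply mul_left_cancel₀ hn'
  linear_combination h0

lemma sin_pi_mul_sub_div {n l : ℕ} (hn : 0 < n) (hl : l ≤ n) :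
    Real.sin (π * (n - l : ℕ) / n) = Real.sin (π * l / n) := by
  have hn' : (n : ℝ) ≠ 0 := by positivity
  have e : π * ((n - l : ℕ) : ℝ) / n = π - π * l / n := by
    rw [Nat.cast_sub hl]
    field_simp
  rw [e, Real.sin_pi_sub]

lemma C_zero (n : ℕ) : C n 0 = S n := by
  simp [C, S]

lemma sum_range_C_sq {n : ℕ} (hn : 0 < n) :
    ∑ ν ∈ range n, (C n (ν : ℤ)) ^ 2
      = n * ∑ l ∈ Finset.Icc 1 (n - 1), 1 / Real.sin (π * l / n) ^ 2 := by
  have h : ∀ ν ∈ range n, (C n (ν : ℤ)) ^ 2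
      = ∑ l ∈ Finset.Icc 1 (n - 1), ∑ m ∈ Finset.Icc 1 (n - 1),
        Real.cos (2 * π * ν * l / n) * Real.cos (2 * π * ν * m / n)
          * (1 / (Real.sin (π * l / n) * Real.sin (π * m / n))) := by
    intro ν _
    rw [C, sq, Finset.sum_mul_sum]
    refine Finset.sum_congr rfl fun l _ => Finset.sum_congr rfl fun m _ => ?_
    rw [Int.cast_natCast, div_mul_div_comm, mul_one_div]
  rw [Finset.sum_congr rfl h, Finset.sum_comm, Finset.mul_sum]
  refine Finset.sum_congr rfl fun l hl => ?_
  rw [Finset.sum_comm]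
  have hl' := Finset.mem_Icc.1 hl
  have hl2 : n - l ∈ Finset.Icc 1 (n - 1) := by rw [Finset.mem_Icc]; omega
  rw [Finset.sum_congr rfl fun m hm => by rw [← Finset.sum_mul, sum_cos_mul_cos hl hm]]
  simp only [add_mul, ite_mul, zero_mul, Finset.sum_add_distrib, Finset.sum_ite_eq',
    hl, hl2, if_true]
  rw [sin_pi_mul_sub_div hn (by omega)]
  ring

theorem sum_C_sq (n : ℕ) (hn : 2 ≤ n) :
    ∑ ν ∈ Finset.Icc 1 (n - 1), (C n (ν : ℤ)) ^ 2
      = (n : ℝ) * ((n : ℝ) ^ 2 - 1) / 3 - (S n) ^ 2 := by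
  have hn0 : 0 < n := by omega
  have h := sum_range_C_sq hn0
  rw [sum_one_div_sin_sq hn0, sum_range_eq_add_sum_Icc _ hn0, Nat.cast_zero, C_zero] at h
  linear_combination h
end

section
/- For all real numbers α, β, b with b > 0 and α + b > |β|, the improper integral ∫₀^∞ e^{−αx}·cosh(βx)/cosh(bx) dx converges and equals (1/(4b)) · [ Ψ(3/4 + (α+β)/(4b)) − Ψ(1/4 + (α−β)/(4b)) + Ψ(3/4 + (α−β)/(4b)) − Ψ(1/4 + (α+β)/(4b)) ]. -/
open Real MeasureTheory

/-- The digamma function `Ψ = Γ'/Γ`. -/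
noncomputable def digamma (x : ℝ) : ℝ := deriv Real.Gamma x / Real.Gamma x

open Filter Topology

theorem differentiableAt_Gamma_of_pos {x : ℝ} (hx : 0 < x) : DifferentiableAt ℝ Real.Gamma x :=
  Real.differentiableAt_Gamma fun m hm => by
    have := Nat.cast_nonneg (α := ℝ) m
    linarith

theorem digamma_add_one {x : ℝ} (hx : 0 < x) : digamma (x + 1) = digamma x + x⁻¹ := by
  have h1 : deriv (fun y => Real.Gamma (y + 1)) x = Real.Gamma x + x * deriv Real.Gamma x := by
    have he : (fun y => Real.Gamma (y + 1)) =ᶠ[𝓝 x] fun y => y * Real.Gamma y := by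
      filter_upwards [lt_mem_nhds hx] with y hy
      exact Real.Gamma_add_one hy.ne'
    rw [he.deriv_eq]
    simpa using ((hasDerivAt_id' x).fun_mul (differentiableAt_Gamma_of_pos hx).hasDerivAt).deriv
  rw [deriv_comp_add_const] at h1
  have hG := (Real.Gamma_pos_of_pos hx).ne'
  rw [digamma, digamma, h1, Real.Gamma_add_one hx.ne']
  field_simp
  ring

theorem monotoneOn_digamma : MonotoneOn digamma (Set.Ioi 0) := by
  have hG : ∀ y ∈ Set.Ioi (0 : ℝ), Real.Gamma y ≠ 0 := fun y hy => (Real.Gamma_pos_of_pos hy).ne'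
  have hm := Real.convexOn_log_Gamma.monotoneOn_deriv
    fun y hy => (differentiableAt_Gamma_of_pos hy).log (hG y hy)
  refine hm.congr fun y hy => ?_
  exact deriv.log (differentiableAt_Gamma_of_pos hy) (hG y hy)

theorem digamma_add_nat {x : ℝ} (hx : 0 < x) (N : ℕ) :
    digamma (x + N) = digamma x + ∑ n ∈ Finset.range N, (x + n)⁻¹ := by
  induction N with
  | zero => simp
  | succ N ih =>
    have : 0 < x + N := by positivity
    rw [Finset.sum_range_succ, ← add_assoc, ← ih, ← digamma_add_one this]
    push_cast
    ring_nf

theorem hasSum_inv_sub_inv_digamma {p q : ℝ} (hp : 0 < p) (hpq : p ≤ q) (hq : q ≤ p + 1) :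
    HasSum (fun n : ℕ => (p + n)⁻¹ - (q + n)⁻¹) (digamma q - digamma p) := by
  have hq0 : 0 < q := hp.trans_le hpq
  rw [hasSum_iff_tendsto_nat_of_nonneg fun n => sub_nonneg.2 (inv_anti₀ (by positivity) (by gcongr))]
  have h0 : Tendsto (fun N : ℕ => digamma (q + N) - digamma (p + N)) atTop (𝓝 0) := by
    have hl : Tendsto (fun N : ℕ => (p + N)⁻¹) atTop (𝓝 0) :=
      tendsto_inv_atTop_zero.comp (tendsto_atTop_add_const_left _ _ tendsto_natCast_atTop_atTop)
    refine squeeze_zero (fun N => ?_) (fun N => ?_) hl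
    · exact sub_nonneg.2 (monotoneOn_digamma (Set.mem_Ioi.2 (by positivity))
        (Set.mem_Ioi.2 (by positivity)) (by gcongr))
    · have hpN : 0 < p + N := by positivity
      rw [sub_le_iff_le_add', ← digamma_add_one hpN]
      exact monotoneOn_digamma (Set.mem_Ioi.2 (by positivity))
        (Set.mem_Ioi.2 (by positivity)) (by linarith)
  have h1 := h0.const_sub (digamma q - digamma p)
  rw [sub_zero] at h1
  refine h1.congr fun N => ?_
  rw [digamma_add_nat hp, digamma_add_nat hq0, Finset.sum_sub_distrib]
  ring

theorem integrableOn_exp_div_cosh {a b : ℝ} (h : 0 < a + b) :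
    IntegrableOn (fun x => Real.exp (-a * x) / Real.cosh (b * x)) (Set.Ioi 0) := by
  have hc : Continuous fun x => Real.exp (-a * x) / Real.cosh (b * x) :=
    (by fun_prop : Continuous fun x => Real.exp (-a * x)).div (by fun_prop)
      fun x => (Real.cosh_pos _).ne'
  refine ((exp_neg_integrableOn_Ioi 0 h).const_mul 2).mono' hc.aestronglyMeasurable
    (ae_of_all _ fun x => ?_)
  rw [Real.norm_of_nonneg (by positivity), div_le_iff₀ (Real.cosh_pos _), Real.cosh_eq]
  have h1 : Real.exp (-a * x) = Real.exp (-(a + b) * x) * Real.exp (b * x) := by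
    rw [← Real.exp_add]
    ring_nf
  rw [h1]
  have := mul_pos (Real.exp_pos (-(a + b) * x)) (Real.exp_pos (-(b * x)))
  linarith

theorem hasSum_exp_div_cosh {a b x : ℝ} (hb : 0 < b) (hx : 0 < x) :
    HasSum (fun n : ℕ => 2 * (Real.exp (-(a + b + 4 * b * n) * x)
        - Real.exp (-(a + 3 * b + 4 * b * n) * x)))
      (Real.exp (-a * x) / Real.cosh (b * x)) := by
  set t := Real.exp (-b * x) with ht
  have ht0 : 0 < t := Real.exp_pos _
  have ht1 : t < 1 := by
    rw [ht, Real.exp_lt_one_iff]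
    nlinarith
  have ht4 : t ^ 4 < 1 := pow_lt_one₀ ht0.le ht1 (by norm_num)
  have hg := (hasSum_geometric_of_lt_one (by positivity) ht4).mul_left
    (2 * Real.exp (-a * x) * (t - t ^ 3))
  convert! hg using 1
  · funext n
    have e1 : Real.exp (-(a + b + 4 * b * n) * x) = Real.exp (-a * x) * t * (t ^ 4) ^ n := by
      rw [ht, ← Real.exp_nat_mul, ← Real.exp_nat_mul, ← Real.exp_add, ← Real.exp_add]
      push_cast
      ring_nf
    have e2 : Real.exp (-(a + 3 * b + 4 * b * n) * x)
        = Real.exp (-a * x) * t ^ 3 * (t ^ 4) ^ n := by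
      rw [ht, ← Real.exp_nat_mul, ← Real.exp_nat_mul, ← Real.exp_nat_mul, ← Real.exp_add,
        ← Real.exp_add]
      push_cast
      ring_nf
    rw [e1, e2]
    ring
  · have e : Real.exp (b * x) = t⁻¹ := by
      rw [ht, ← Real.exp_neg]
      ring_nf
    have hn : (1 : ℝ) - t ^ 4 ≠ 0 := by linarith
    rw [Real.cosh_eq, Real.exp_neg, e]
    field_simp
    ring

theorem integral_exp_div_cosh {a b : ℝ} (hb : 0 < b) (h : 0 < a + b) :
    ∫ x in Set.Ioi (0 : ℝ), Real.exp (-a * x) / Real.cosh (b * x)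
      = 1 / (2 * b) * (digamma (3 / 4 + a / (4 * b)) - digamma (1 / 4 + a / (4 * b))) := by
  set p := 1 / 4 + a / (4 * b) with hp
  set q := 3 / 4 + a / (4 * b) with hq
  have hab : a + b = 4 * b * p := by rw [hp]; field_simp; ring
  have hab3 : a + 3 * b = 4 * b * q := by rw [hq]; field_simp; ring
  have hp0 : 0 < p := by
    rw [hab] at h
    exact pos_of_mul_pos_right h (by positivity)
  have hq0 : 0 < q := by linarith
  set F : ℕ → ℝ → ℝ := fun n x => 2 * (Real.exp (-(a + b + 4 * b * n) * x)
        - Real.exp (-(a + 3 * b + 4 * b * n) * x)) with hF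
  have h1 : ∀ n : ℕ, 0 < a + b + 4 * b * n := fun n => by positivity
  have h3 : ∀ n : ℕ, 0 < a + 3 * b + 4 * b * n := fun n => by linarith [h1 n]
  have hexp : ∀ c : ℝ, 0 < c → ∫ x in Set.Ioi (0 : ℝ), Real.exp (-c * x) = c⁻¹ := fun c hc => by
    rw [integral_exp_mul_Ioi (by linarith) 0]
    simp
  have hFint : ∀ n, Integrable (F n) (volume.restrict (Set.Ioi 0)) := fun n =>
    ((exp_neg_integrableOn_Ioi 0 (h1 n)).sub (exp_neg_integrableOn_Ioi 0 (h3 n))).const_mul 2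
  have hval : ∀ n, ∫ x in Set.Ioi (0 : ℝ), F n x
      = 1 / (2 * b) * ((p + n)⁻¹ - (q + n)⁻¹) := fun n => by
    rw [hF, integral_const_mul, integral_sub (exp_neg_integrableOn_Ioi 0 (h1 n))
      (exp_neg_integrableOn_Ioi 0 (h3 n)), hexp _ (h1 n), hexp _ (h3 n), hab, hab3]
    have : p + n ≠ 0 := by positivity
    have : q + n ≠ 0 := by positivity
    rw [← mul_add, ← mul_add]
    field_simp
    ring
  have hsum := (hasSum_inv_sub_inv_digamma hp0 (by linarith : p ≤ q) (by linarith)).mul_left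
    (1 / (2 * b))
  have hnorm : ∀ n, ∫ x in Set.Ioi (0 : ℝ), ‖F n x‖ = ∫ x in Set.Ioi (0 : ℝ), F n x := fun n =>
    setIntegral_congr_fun measurableSet_Ioi fun x hx => by
      have hx : 0 < x := hx
      refine Real.norm_of_nonneg (mul_nonneg zero_le_two (sub_nonneg.2 (Real.exp_le_exp.2 ?_)))
      nlinarith [mul_pos hb hx]
  have hI := hasSum_integral_of_summable_integral_norm hFint
    (by simpa only [hnorm, hval] using hsum.summable)
  simp only [hval] at hI
  rw [← hI.unique hsum]
  exact setIntegral_congr_fun measurableSet_Ioi fun x hx => (hasSum_exp_div_cosh hb hx).tsum_eq.symm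

theorem integral_exp_cosh_div_cosh (α β b : ℝ) (hb : 0 < b) (h : |β| < α + b) :
    IntegrableOn (fun x => Real.exp (-α * x) * Real.cosh (β * x) / Real.cosh (b * x))
        (Set.Ioi (0 : ℝ)) ∧
    ∫ x in Set.Ioi (0 : ℝ), Real.exp (-α * x) * Real.cosh (β * x) / Real.cosh (b * x)
      = (1 / (4 * b)) *
          (digamma (3 / 4 + (α + β) / (4 * b)) - digamma (1 / 4 + (α - β) / (4 * b))
            + digamma (3 / 4 + (α - β) / (4 * b)) - digamma (1 / 4 + (α + β) / (4 * b))) := by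
  obtain ⟨hβ₁, hβ₂⟩ := abs_lt.1 h
  have hplus : 0 < α + β + b := by linarith
  have hminus : 0 < α - β + b := by linarith
  have heq : (fun x => Real.exp (-α * x) * Real.cosh (β * x) / Real.cosh (b * x)) = fun x =>
      1 / 2 * (Real.exp (-(α + β) * x) / Real.cosh (b * x)
        + Real.exp (-(α - β) * x) / Real.cosh (b * x)) := by
    funext x
    have e1 : Real.exp (-(α + β) * x) = Real.exp (-α * x) * Real.exp (-(β * x)) := by
      rw [← Real.exp_add]
      ring_nf
    have e2 : Real.exp (-(α - β) * x) = Real.exp (-α * x) * Real.exp (β * x) := by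
      rw [← Real.exp_add]
      ring_nf
    rw [e1, e2, Real.cosh_eq (β * x)]
    ring
  have hi₁ := integrableOn_exp_div_cosh hplus
  have hi₂ := integrableOn_exp_div_cosh hminus
  rw [heq]
  refine ⟨(hi₁.add hi₂).const_mul _, ?_⟩
  rw [integral_const_mul, integral_add hi₁ hi₂, integral_exp_div_cosh hb hplus,
    integral_exp_div_cosh hb hminus]
  field_simp
  ring
end
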